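/- Let $0<\beta<\tfrac12$, $a\ge 0$ and $h>0$. Then $\int_0^{a} \big((a-s)^{-\beta} - (a+h-s)^{-\beta}\big)^2\,ds \le \frac{2\beta}{(1-\beta)(1-2\beta)}\,h^{1-2\beta}$. -/

import Mathlib

open MeasureTheory Set

/-- Bernoulli-type lower bound for a shifted negative power. -/
theorem rpow_neg_mul_one_sub_le_add_rpow_neg {β x h : ℝ} (hβ0 : 0 ≤ β) (hβ : β ≤ 1)
    (hx : 0 < x) (hh : 0 ≤ h) :
    x ^ (-β) * (1 - β * (h / x)) ≤ (x + h) ^ (-β) := by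
  have hs : 0 ≤ h / x := by positivity
  have hxh : x + h = x * (1 + h / x) := by field_simp
  rw [hxh, Real.mul_rpow hx.le (by positivity)]
  refine mul_le_mul_of_nonneg_left ?_ (by positivity)
  have hB : (1 + h / x) ^ β ≤ 1 + β * (h / x) :=
    rpow_one_add_le_one_add_mul_self (by linarith) hβ0 hβ
  have hpos : 0 < (1 + h / x) ^ β := by positivity
  rw [Real.rpow_neg (by positivity), ← one_div, le_div_iff₀ hpos]
  by_cases hc : 0 ≤ 1 - β * (h / x)
  · nlinarith [mul_le_mul_of_nonneg_left hB hc, sq_nonneg (β * (h / x))]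
  · nlinarith

theorem rpow_sq_eq {t p : ℝ} (ht : 0 ≤ t) : (t ^ p) ^ 2 = t ^ (2 * p) := by
  rw [← Real.rpow_mul_natCast ht, mul_comm]
  norm_num

theorem rpow_neg_sub_add_rpow_neg_nonneg {β h t : ℝ} (hβ0 : 0 ≤ β) (hh : 0 ≤ h) (ht : 0 < t) :
    0 ≤ t ^ (-β) - (t + h) ^ (-β) :=
  sub_nonneg.2 (Real.rpow_le_rpow_of_nonpos ht (by linarith) (by linarith))

theorem intervalIntegrable_sq_rpow_neg_sub {β h b : ℝ} (hβ0 : 0 < β) (hβ : β < 1 / 2)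
    (hh : 0 ≤ h) (hb : 0 ≤ b) :
    IntervalIntegrable (fun t : ℝ => (t ^ (-β) - (t + h) ^ (-β)) ^ 2) volume 0 b := by
  have hd : IntervalIntegrable (fun t : ℝ => t ^ (2 * -β)) volume 0 b :=
    intervalIntegral.intervalIntegrable_rpow' (by linarith)
  rw [intervalIntegrable_iff_integrableOn_Ioc_of_le hb] at hd ⊢
  refine Integrable.mono' hd (Measurable.aestronglyMeasurable (by fun_prop)) ?_
  refine (ae_restrict_iff' measurableSet_Ioc).2 (Filter.Eventually.of_forall fun t ht => ?_)
  have h0 := rpow_neg_sub_add_rpow_neg_nonneg hβ0.le hh ht.1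
  have hg : 0 ≤ (t + h) ^ (-β) := Real.rpow_nonneg (by linarith [ht.1]) _
  rw [Real.norm_of_nonneg (sq_nonneg _), ← rpow_sq_eq ht.1.le]
  exact pow_le_pow_left₀ h0 (by linarith) 2

/-- The contribution of the interval `[0, h]`. -/
theorem integral_sq_rpow_neg_sub_near {β h : ℝ} (hβ0 : 0 < β) (hβ : β < 1 / 2) (hh : 0 < h) :
    (∫ t in (0 : ℝ)..h, (t ^ (-β) - (t + h) ^ (-β)) ^ 2)
      ≤ (1 / (1 - 2 * β) - 2 + (1 - β) ^ 2) * h ^ (1 - 2 * β) := by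
  set c : ℝ := h ^ (-β) * (1 - β) with hc
  have h2 : IntervalIntegrable (fun t : ℝ => t ^ (2 * -β)) volume 0 h :=
    intervalIntegral.intervalIntegrable_rpow' (by linarith)
  have h1 : IntervalIntegrable (fun t : ℝ => t ^ (-β)) volume 0 h :=
    intervalIntegral.intervalIntegrable_rpow' (by linarith)
  have h3 : IntervalIntegrable (fun t : ℝ => t ^ (2 * -β) - 2 * c * t ^ (-β)) volume 0 h :=
    h2.sub (h1.const_mul _)
  have h4 : IntervalIntegrable (fun _ : ℝ => c ^ 2) volume 0 h := by simp
  have hmono : (∫ t in (0 : ℝ)..h, (t ^ (-β) - (t + h) ^ (-β)) ^ 2)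
      ≤ ∫ t in (0 : ℝ)..h, (t ^ (2 * -β) - 2 * c * t ^ (-β) + c ^ 2) := by
    refine intervalIntegral.integral_mono_on_of_le_Ioo hh.le
      (intervalIntegrable_sq_rpow_neg_sub hβ0 hβ hh.le hh.le) (h3.add h4) fun t ht => ?_
    have h0 := rpow_neg_sub_add_rpow_neg_nonneg hβ0.le hh.le ht.1
    have hcg : c ≤ (t + h) ^ (-β) := by
      have hB := rpow_neg_mul_one_sub_le_add_rpow_neg hβ0.le (by linarith) hh hh.le
      rw [div_self hh.ne', mul_one] at hB
      exact hB.trans (Real.rpow_le_rpow_of_nonpos (by linarith [ht.1]) (by linarith [ht.2])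
        (by linarith))
    rw [← rpow_sq_eq ht.1.le]
    nlinarith [pow_le_pow_left₀ h0 (sub_le_sub_left hcg (t ^ (-β))) 2]
  refine hmono.trans (le_of_eq ?_)
  rw [intervalIntegral.integral_add h3 h4, intervalIntegral.integral_sub h2 (h1.const_mul _),
    intervalIntegral.integral_const_mul, integral_rpow (Or.inl (by linarith)),
    integral_rpow (Or.inl (by linarith)), intervalIntegral.integral_const,
    Real.zero_rpow (by linarith), Real.zero_rpow (by linarith)]
  have e1 : h ^ (1 - 2 * β) = (h ^ (-β)) ^ 2 * h := by
    rw [rpow_sq_eq hh.le, ← Real.rpow_add_one hh.ne']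
    ring_nf
  have e2 : h ^ (2 * -β + 1) = (h ^ (-β)) ^ 2 * h := by
    rw [rpow_sq_eq hh.le, ← Real.rpow_add_one hh.ne']
  have e3 : 2 * -β + 1 = 1 - 2 * β := by ring
  have e4 : -β + 1 = 1 - β := by ring
  have n1 : 1 - 2 * β ≠ 0 := by linarith
  have n2 : 1 - β ≠ 0 := by linarith
  rw [e1, e2, Real.rpow_add_one hh.ne', e3, e4, hc, smul_eq_mul]
  field_simp
  ring

/-- The contribution of an interval `[h, b]`. -/
theorem integral_sq_rpow_neg_sub_far {β h b : ℝ} (hβ0 : 0 < β) (hβ : β < 1 / 2) (hh : 0 < h)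
    (hb : h ≤ b) :
    (∫ t in h..b, (t ^ (-β) - (t + h) ^ (-β)) ^ 2) ≤ β ^ 2 * h ^ (1 - 2 * β) := by
  have hb0 : 0 < b := hh.trans_le hb
  have hnot : (0 : ℝ) ∉ uIcc h b := by
    rw [uIcc_of_le hb]
    exact fun hz => absurd hz.1 (not_le.2 hh)
  have hi : IntervalIntegrable (fun t : ℝ => t ^ (-2 * β - 2)) volume h b :=
    intervalIntegral.intervalIntegrable_rpow (Or.inr hnot)
  have hF : IntervalIntegrable (fun t : ℝ => (t ^ (-β) - (t + h) ^ (-β)) ^ 2) volume h b :=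
    (intervalIntegrable_sq_rpow_neg_sub hβ0 hβ hh.le hb0.le).mono_set (by
      rw [uIcc_of_le hb, uIcc_of_le hb0.le]
      exact Icc_subset_Icc_left hh.le)
  have hmono : (∫ t in h..b, (t ^ (-β) - (t + h) ^ (-β)) ^ 2)
      ≤ ∫ t in h..b, β ^ 2 * h ^ 2 * t ^ (-2 * β - 2) := by
    refine intervalIntegral.integral_mono_on hb hF (hi.const_mul _) fun t ht => ?_
    have ht0 : 0 < t := hh.trans_le ht.1
    have h0 := rpow_neg_sub_add_rpow_neg_nonneg hβ0.le hh.le ht0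
    have hB := rpow_neg_mul_one_sub_le_add_rpow_neg hβ0.le (by linarith) ht0 hh.le
    have hle : t ^ (-β) - (t + h) ^ (-β) ≤ t ^ (-β) * (β * (h / t)) := by linarith
    refine (pow_le_pow_left₀ h0 hle 2).trans (le_of_eq ?_)
    have e : t ^ (-2 * β - 2) = (t ^ (-β)) ^ 2 / t ^ 2 := by
      rw [rpow_sq_eq ht0.le, ← Real.rpow_natCast t 2, ← Real.rpow_sub ht0]
      norm_num
    rw [e]
    field_simp
  refine hmono.trans ?_
  rw [intervalIntegral.integral_const_mul, integral_rpow (Or.inr ⟨by linarith, hnot⟩)]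
  have e : h ^ (1 - 2 * β) = h ^ 2 * h ^ (-2 * β - 2 + 1) := by
    rw [← Real.rpow_natCast h 2, ← Real.rpow_add hh]
    congr 1
    push_cast
    ring
  rw [e, mul_assoc]
  refine mul_le_mul_of_nonneg_left (mul_le_mul_of_nonneg_left ?_ (by positivity)) (by positivity)
  have hpb : 0 ≤ b ^ (-2 * β - 2 + 1) := by positivity
  have hph : 0 ≤ h ^ (-2 * β - 2 + 1) := by positivity
  rw [div_le_iff_of_neg (by linarith)]
  nlinarith

/-- Sharp squared-difference kernel estimate (Theorem 3.3):
`∫_0^a ((a-s)^{-β} - (a+h-s)^{-β})² ds ≤ (2β / ((1-β)(1-2β))) h^{1-2β}`. -/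
theorem squared_kernel_difference_bound (β a h : ℝ)
    (hβ0 : 0 < β) (hβ : β < 1 / 2) (ha : 0 ≤ a) (hh : 0 < h) :
    (∫ s in (0 : ℝ)..a, ((a - s) ^ (-β) - (a + h - s) ^ (-β)) ^ 2)
      ≤ 2 * β / ((1 - β) * (1 - 2 * β)) * h ^ (1 - 2 * β) := by
  have hsub : (∫ s in (0 : ℝ)..a, ((a - s) ^ (-β) - (a + h - s) ^ (-β)) ^ 2)
      = ∫ t in (0 : ℝ)..a, (t ^ (-β) - (t + h) ^ (-β)) ^ 2 := by
    have hs := intervalIntegral.integral_comp_sub_left (a := 0) (b := a)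
      (fun t : ℝ => (t ^ (-β) - (t + h) ^ (-β)) ^ 2) a
    rw [sub_self, sub_zero] at hs
    rw [← hs]
    simp only [add_sub_right_comm]
  have hint : ∀ {b : ℝ}, 0 ≤ b →
      IntervalIntegrable (fun t : ℝ => (t ^ (-β) - (t + h) ^ (-β)) ^ 2) volume 0 b :=
    fun hb => intervalIntegrable_sq_rpow_neg_sub hβ0 hβ hh.le hb
  have hmax : 0 ≤ max a h := ha.trans (le_max_left _ _)
  have hext : (∫ t in (0 : ℝ)..a, (t ^ (-β) - (t + h) ^ (-β)) ^ 2)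
      ≤ ∫ t in (0 : ℝ)..(max a h), (t ^ (-β) - (t + h) ^ (-β)) ^ 2 :=
    intervalIntegral.integral_mono_interval le_rfl ha (le_max_left _ _)
      (Filter.Eventually.of_forall fun t => sq_nonneg _) (hint hmax)
  have hsplit := intervalIntegral.integral_add_adjacent_intervals (hint hh.le)
    ((hint hh.le).symm.trans (hint hmax))
  have hnear := integral_sq_rpow_neg_sub_near hβ0 hβ hh
  have hfar := integral_sq_rpow_neg_sub_far hβ0 hβ hh (le_max_right a h)
  have hconst : 1 / (1 - 2 * β) - 2 + (1 - β) ^ 2 + β ^ 2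
      ≤ 2 * β / ((1 - β) * (1 - 2 * β)) := by
    have p1 : 0 < 1 - β := by linarith
    have p2 : 0 < 1 - 2 * β := by linarith
    have e : 2 * β / ((1 - β) * (1 - 2 * β)) - (1 / (1 - 2 * β) - 2 + (1 - β) ^ 2 + β ^ 2)
        = β * (2 - (1 - β) * (6 * β - 4 * β ^ 2)) / ((1 - β) * (1 - 2 * β)) := by
      field_simp
      ring
    have hnum : 0 ≤ 2 - (1 - β) * (6 * β - 4 * β ^ 2) := by
      nlinarith [sq_nonneg (2 * β - 1), mul_nonneg p1.le (sq_nonneg β)]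
    rw [← sub_nonneg, e]
    positivity
  have hpow : 0 ≤ h ^ (1 - 2 * β) := by positivity
  have hfinal := mul_le_mul_of_nonneg_right hconst hpow
  rw [hsub]
  linarith
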